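/- arXiv:2604.25907 — 4 statements merged into one kernel-verified Lean document; each statement's English description precedes it below -/
import Mathlib

section
/- Fix q ∈ (0,1] and K ≥ 1, and let α_1, …, α_K > 0 with ∑_j α_j = 1. Then the function J(θ) = ∑_{j=1}^K α_j · (−log_q θ_j) on the probability simplex Δ_K = {θ ∈ ℝ^K : θ_j ≥ 0, ∑_j θ_j = 1} (with the convention −log_q(0) = +∞ for q = 1, and −log_q(0) = 1/(1−q) for q < 1) has a unique minimizer, given by the escort distribution θ*_j(q) = α_j^{1/q} / ∑_{k=1}^K α_k^{1/q}. -/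
open scoped ENNReal

/-- The negated Tsallis q-logarithm `−log_q(u)` for `u ∈ [0,1]`, valued in `ℝ≥0∞`.
For `q = 1` it is `−log u`, with the convention `−log_1(0) = +∞`; for `q ≠ 1` it is
`(1 − u^{1−q})/(1 − q)`, which at `u = 0` and `q < 1` automatically evaluates to
`1/(1−q)` (since `0^{1−q} = 0` for `1−q > 0`). -/
noncomputable def negLogqE (q u : ℝ) : ℝ≥0∞ :=
  if q = 1 then (if u = 0 then ⊤ else ENNReal.ofReal (-Real.log u))
  else ENNReal.ofReal ((1 - u ^ (1 - q)) / (1 - q))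

/-- The real-valued negated Tsallis `q`-logarithm. -/
noncomputable def negLogq (q u : ℝ) : ℝ :=
  if q = 1 then -Real.log u else (1 - u ^ (1 - q)) / (1 - q)

theorem negLogqE_eq_ofReal {q u : ℝ} (hu : q = 1 → u ≠ 0) :
    negLogqE q u = ENNReal.ofReal (negLogq q u) := by
  unfold negLogqE negLogq
  split_ifs with h h' <;> simp_all

theorem negLogq_nonneg {q u : ℝ} (hq : q ≤ 1) (h0 : 0 ≤ u) (h1 : u ≤ 1) :
    0 ≤ negLogq q u := by
  unfold negLogq
  split_ifs with h
  · exact neg_nonneg.2 (Real.log_nonpos h0 h1)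
  · exact div_nonneg (sub_nonneg.2 (Real.rpow_le_one h0 h1 (by linarith))) (by linarith)

/-- The negated `q`-logarithm lies strictly above its tangent lines away from the point of
tangency. -/
theorem negLogq_tangent_lt {q t u : ℝ} (hq0 : 0 < q) (hq1 : q ≤ 1) (ht : 0 < t) (hu : 0 ≤ u)
    (hu' : q = 1 → u ≠ 0) (hne : u ≠ t) :
    negLogq q t - t ^ (-q) * (u - t) < negLogq q u := by
  have hx : u / t ≠ 1 := fun h => hne ((div_eq_one_iff_eq ht.ne').1 h)
  unfold negLogq
  split_ifs with h
  · have hu0 : 0 < u := lt_of_le_of_ne hu (hu' h).symm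
    have key := Real.log_lt_sub_one_of_pos (div_pos hu0 ht) hx
    rw [Real.log_div hu0.ne' ht.ne'] at key
    have : t ^ (-q) * (u - t) = u / t - 1 := by
      rw [h, Real.rpow_neg_one]
      field_simp
    linarith
  · have hp : 0 < 1 - q := sub_pos.2 (lt_of_le_of_ne hq1 h)
    have key := rpow_one_add_lt_one_add_mul_self (s := u / t - 1) (p := 1 - q)
      (by linarith [div_nonneg hu ht.le]) (sub_ne_zero.2 hx) hp (by linarith)
    rw [add_sub_cancel, Real.div_rpow hu ht.le, div_lt_iff₀ (Real.rpow_pos_of_pos ht _)] at key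
    have htq : t ^ (1 - q) = t * t ^ (-q) := by
      rw [sub_eq_add_neg, Real.rpow_add ht, Real.rpow_one]
    have e : (1 + (1 - q) * (u / t - 1)) * t ^ (1 - q)
        = t ^ (1 - q) + (1 - q) * (t ^ (-q) * (u - t)) := by
      rw [htq]
      field_simp
    rw [e] at key
    rw [lt_div_iff₀ hp, sub_mul, div_mul_cancel₀ _ hp.ne']
    linarith

theorem negLogq_tangent_le {q t u : ℝ} (hq0 : 0 < q) (hq1 : q ≤ 1) (ht : 0 < t) (hu : 0 ≤ u)
    (hu' : q = 1 → u ≠ 0) :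
    negLogq q t - t ^ (-q) * (u - t) ≤ negLogq q u := by
  rcases eq_or_ne u t with rfl | hne
  · simp
  · exact (negLogq_tangent_lt hq0 hq1 ht hu hu' hne).le

theorem sum_ofReal_mul_negLogqE {ι : Type*} [Fintype ι] {q : ℝ} (hq : q ≤ 1) {α θ : ι → ℝ}
    (hα : ∀ j, 0 ≤ α j) (h0 : ∀ j, 0 ≤ θ j) (h1 : ∑ j, θ j = 1) (h : q = 1 → ∀ j, θ j ≠ 0) :
    ∑ j, ENNReal.ofReal (α j) * negLogqE q (θ j)
      = ENNReal.ofReal (∑ j, α j * negLogq q (θ j)) := by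
  have hle : ∀ j, θ j ≤ 1 := fun j =>
    h1 ▸ Finset.single_le_sum (fun i _ => h0 i) (Finset.mem_univ j)
  rw [ENNReal.ofReal_sum_of_nonneg
    fun j _ => mul_nonneg (hα j) (negLogq_nonneg hq (h0 j) (hle j))]
  refine Finset.sum_congr rfl fun j _ => ?_
  rw [negLogqE_eq_ofReal fun hq => h hq j, ENNReal.ofReal_mul (hα j)]

/-- For `q ∈ (0,1]`, `K ≥ 1`, and positive frequencies `α` summing
to `1`, the objective `J(θ) = ∑ j, α j · (−log_q θ j)` on the probability simplex has
the escort distribution `θ*_j = α_j^{1/q} / ∑ k α_k^{1/q}` as its unique minimizer. -/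
theorem escort_unique_minimizer
    {q : ℝ} (hq0 : 0 < q) (hq1 : q ≤ 1) {K : ℕ} (hK : 1 ≤ K)
    (α : Fin K → ℝ) (hα : ∀ j, 0 < α j) (hαsum : ∑ j, α j = 1) :
    let J : (Fin K → ℝ) → ℝ≥0∞ :=
      fun θ => ∑ j, ENNReal.ofReal (α j) * negLogqE q (θ j)
    let θstar : Fin K → ℝ := fun j => α j ^ (1 / q) / ∑ k, α k ^ (1 / q)
    (∀ j, 0 ≤ θstar j) ∧ (∑ j, θstar j = 1) ∧
      ∀ θ : Fin K → ℝ, (∀ j, 0 ≤ θ j) → (∑ j, θ j = 1) → θ ≠ θstar →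
        J θstar < J θ := by
  intro J θstar
  have hne : (Finset.univ : Finset (Fin K)).Nonempty := ⟨⟨0, hK⟩, Finset.mem_univ _⟩
  have hpow : ∀ j, 0 < α j ^ (1 / q) := fun j => Real.rpow_pos_of_pos (hα j) _
  have hS : 0 < ∑ k, α k ^ (1 / q) := Finset.sum_pos (fun j _ => hpow j) hne
  have hpos : ∀ j, 0 < θstar j := fun j => div_pos (hpow j) hS
  have hsum : ∑ j, θstar j = 1 := by
    simp only [θstar]
    rw [← Finset.sum_div, div_self hS.ne']
  refine ⟨fun j => (hpos j).le, hsum, fun θ h0 h1 hθ => ?_⟩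
  have hJstar : J θstar = ENNReal.ofReal (∑ j, α j * negLogq q (θstar j)) :=
    sum_ofReal_mul_negLogqE hq1 (fun j => (hα j).le) (fun j => (hpos j).le) hsum
      fun _ j => (hpos j).ne'
  by_cases hz : q = 1 → ∀ j, θ j ≠ 0
  · have hJ : J θ = ENNReal.ofReal (∑ j, α j * negLogq q (θ j)) :=
      sum_ofReal_mul_negLogqE hq1 (fun j => (hα j).le) h0 h1 hz
    have hslope : ∀ j, α j * θstar j ^ (-q) = (∑ k, α k ^ (1 / q)) ^ q := by
      intro j
      simp only [θstar]
      rw [Real.rpow_neg (hpos j).le, Real.div_rpow (hpow j).le hS.le, ← Real.rpow_mul (hα j).le,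
        one_div_mul_cancel hq0.ne', Real.rpow_one, inv_div, mul_div_cancel₀ _ (hα j).ne']
    have htangent : ∀ j, α j * (negLogq q (θstar j) - θstar j ^ (-q) * (θ j - θstar j))
        = α j * negLogq q (θstar j) - (∑ k, α k ^ (1 / q)) ^ q * (θ j - θstar j) := by
      intro j
      rw [← hslope j]
      ring
    obtain ⟨i, hi⟩ := Function.ne_iff.1 hθ
    have hlt : ∑ j, α j * (negLogq q (θstar j) - θstar j ^ (-q) * (θ j - θstar j))
        < ∑ j, α j * negLogq q (θ j) :=
      Finset.sum_lt_sum
        (fun j _ => mul_le_mul_of_nonneg_left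
          (negLogq_tangent_le hq0 hq1 (hpos j) (h0 j) fun h => hz h j) (hα j).le)
        ⟨i, Finset.mem_univ i, mul_lt_mul_of_pos_left
          (negLogq_tangent_lt hq0 hq1 (hpos i) (h0 i) (fun h => hz h i) hi) (hα i)⟩
    simp only [htangent] at hlt
    rw [Finset.sum_sub_distrib, ← Finset.mul_sum, Finset.sum_sub_distrib, h1, hsum, sub_self,
      mul_zero, sub_zero] at hlt
    have hnonneg : 0 ≤ ∑ j, α j * negLogq q (θstar j) :=
      Finset.sum_nonneg fun j _ => mul_nonneg (hα j).le (negLogq_nonneg hq1 (hpos j).le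
        (hsum ▸ Finset.single_le_sum (fun i _ => (hpos i).le) (Finset.mem_univ j)))
    rw [hJstar, hJ]
    exact (ENNReal.ofReal_lt_ofReal_iff (hnonneg.trans_lt hlt)).2 hlt
  · push Not at hz
    obtain ⟨hq, i, hi⟩ := hz
    have hJ : J θ = ⊤ := by
      refine ENNReal.sum_eq_top.2 ⟨i, Finset.mem_univ i, ?_⟩
      simp [negLogqE, hq, hi, ENNReal.mul_top, hα i]
    rw [hJstar, hJ]
    exact ENNReal.ofReal_lt_top
end

section
/- For q ∈ (0,1], consider the scoring rule S_q(θ, α) = ∑_{j=1}^K α_j log_q(θ_j) over the probability simplex Δ_K with K ≥ 2, where α has all positive entries. Then: (1) if q = 1, α is the unique maximizer of θ ↦ S_1(θ, α) for every such α (the rule is strictly proper); and (2) if q ∈ (0,1), then for every non-uniform α with positive entries, α is not a maximizer of θ ↦ S_q(θ, α), since the unique maximizer is the escort distribution θ*_j(q) = α_j^{1/q} / ∑_k α_k^{1/q} ≠ α (the rule is not proper). -/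
/-- The Tsallis q-logarithm `log_q(u)` for `u ∈ [0,1]`, valued in `EReal`.
For `q = 1` it is `log u`, with the convention `log_1(0) = −∞`; for `q ≠ 1` it is
`(u^{1−q} − 1)/(1 − q)`, which at `u = 0` and `q < 1` evaluates to `−1/(1−q)`. -/
noncomputable def logqE (q u : ℝ) : EReal :=
  if q = 1 then (if u = 0 then ⊥ else ((Real.log u : ℝ) : EReal))
  else (((u ^ (1 - q) - 1) / (1 - q) : ℝ) : EReal)

theorem sum_mul_log_lt_of_ne {ι : Type*} [Fintype ι] {α θ : ι → ℝ} (hα : ∀ j, 0 < α j)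
    (hθ : ∀ j, 0 < θ j) (hsum : ∑ j, θ j = ∑ j, α j) (hne : θ ≠ α) :
    ∑ j, α j * Real.log (θ j) < ∑ j, α j * Real.log (α j) := by
  obtain ⟨i, hi⟩ := Function.ne_iff.mp hne
  have key : ∑ j, α j * (Real.log (θ j) - Real.log (α j)) < ∑ j, (θ j - α j) := by
    have cancel : ∀ j, α j * (θ j / α j - 1) = θ j - α j := fun j => by
      have := (hα j).ne'
      field_simp
    refine Finset.sum_lt_sum (fun j _ => ?_) ⟨i, Finset.mem_univ i, ?_⟩
    · rw [← Real.log_div (hθ j).ne' (hα j).ne', ← cancel j]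
      exact mul_le_mul_of_nonneg_left
        (Real.log_le_sub_one_of_pos (div_pos (hθ j) (hα j))) (hα j).le
    · rw [← Real.log_div (hθ i).ne' (hα i).ne', ← cancel i]
      refine mul_lt_mul_of_pos_left
        (Real.log_lt_sub_one_of_pos (div_pos (hθ i) (hα i)) fun h => hi ?_) (hα i)
      exact (div_eq_one_iff_eq (hα i).ne').mp h
  simp only [mul_sub, Finset.sum_sub_distrib] at key
  linarith

theorem rpow_mul_rpow_lt_of_ne {q x y : ℝ} (hq0 : 0 < q) (hq1 : q < 1) (hx : 0 ≤ x)
    (hy : 0 < y) (hne : x ≠ y) : y ^ q * x ^ (1 - q) < (1 - q) * x + q * y := by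
  have h := rpow_one_add_lt_one_add_mul_self (s := x / y - 1) (p := 1 - q)
    (by linarith [div_nonneg hx hy.le])
    (fun h => hne ((div_eq_one_iff_eq hy.ne').mp (sub_eq_zero.mp h)))
    (by linarith) (by linarith)
  rw [add_sub_cancel, Real.div_rpow hx hy.le] at h
  have hyq : y ^ q * y ^ (1 - q) = y := by
    rw [← Real.rpow_add hy, add_sub_cancel, Real.rpow_one]
  have hpos : 0 < y ^ (1 - q) := Real.rpow_pos_of_pos hy _
  calc y ^ q * x ^ (1 - q) = (y ^ q * y ^ (1 - q)) * (x ^ (1 - q) / y ^ (1 - q)) := by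
        field_simp
    _ = y * (x ^ (1 - q) / y ^ (1 - q)) := by rw [hyq]
    _ < y * (1 + (1 - q) * (x / y - 1)) := mul_lt_mul_of_pos_left h hy
    _ = (1 - q) * x + q * y := by
        field_simp
        ring

theorem sum_rpow_mul_rpow_lt_of_ne {ι : Type*} [Fintype ι] {q : ℝ} (hq0 : 0 < q) (hq1 : q < 1)
    {θ φ : ι → ℝ} (hθ : ∀ j, 0 ≤ θ j) (hφ : ∀ j, 0 < φ j) (hsum : ∑ j, θ j = ∑ j, φ j)
    (hne : θ ≠ φ) :
    ∑ j, φ j ^ q * θ j ^ (1 - q) < ∑ j, φ j ^ q * φ j ^ (1 - q) := by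
  obtain ⟨i, hi⟩ := Function.ne_iff.mp hne
  have hself : ∀ j, φ j ^ q * φ j ^ (1 - q) = φ j := fun j => by
    rw [← Real.rpow_add (hφ j), add_sub_cancel, Real.rpow_one]
  calc ∑ j, φ j ^ q * θ j ^ (1 - q) < ∑ j, ((1 - q) * θ j + q * φ j) := by
        refine Finset.sum_lt_sum (fun j _ => ?_) ⟨i, Finset.mem_univ i,
          rpow_mul_rpow_lt_of_ne hq0 hq1 (hθ i) (hφ i) hi⟩
        by_cases h : θ j = φ j
        · rw [h, hself]
          linarith
        · exact (rpow_mul_rpow_lt_of_ne hq0 hq1 (hθ j) (hφ j) h).le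
    _ = ∑ j, φ j ^ q * φ j ^ (1 - q) := by
        simp only [hself, Finset.sum_add_distrib, ← Finset.mul_sum, hsum]
        ring

theorem EReal.coe_finset_sum {ι : Type*} (s : Finset ι) (f : ι → ℝ) :
    ((∑ j ∈ s, f j : ℝ) : EReal) = ∑ j ∈ s, (f j : EReal) :=
  map_sum (⟨⟨Real.toEReal, EReal.coe_zero⟩, EReal.coe_add⟩ : ℝ →+ EReal) f s

theorem EReal.finset_sum_eq_bot {ι : Type*} [DecidableEq ι] {s : Finset ι} {f : ι → EReal} {i : ι}
    (hi : i ∈ s) (h : f i = ⊥) : ∑ j ∈ s, f j = ⊥ := by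
  rw [← Finset.add_sum_erase s f hi, h, EReal.bot_add]

theorem sum_mul_logqE_of_ne_one {ι : Type*} [Fintype ι] {q : ℝ} (hq : q ≠ 1) (α θ : ι → ℝ) :
    ∑ j, (α j : EReal) * logqE q (θ j) =
      ((∑ j, α j * ((θ j ^ (1 - q) - 1) / (1 - q)) : ℝ) : EReal) := by
  simp only [logqE, if_neg hq, EReal.coe_finset_sum, EReal.coe_mul]

theorem sum_mul_logqE_one {ι : Type*} [Fintype ι] (α : ι → ℝ) {θ : ι → ℝ} (hθ : ∀ j, θ j ≠ 0) :
    ∑ j, (α j : EReal) * logqE 1 (θ j) = ((∑ j, α j * Real.log (θ j) : ℝ) : EReal) := by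
  simp only [logqE, if_true, if_neg (hθ _), EReal.coe_finset_sum, EReal.coe_mul]

theorem escort_ne_self {ι : Type*} [Fintype ι] {q : ℝ} (hq0 : 0 < q) (hq1 : q < 1) {α : ι → ℝ}
    (hα : ∀ j, 0 < α j) (hne : ∃ j k, α j ≠ α k) :
    (fun j => α j ^ (1 / q) / ∑ k, α k ^ (1 / q)) ≠ α := by
  intro h
  obtain ⟨i, k, hik⟩ := hne
  have hC : 0 < ∑ k, α k ^ (1 / q) :=
    Finset.sum_pos (fun j _ => Real.rpow_pos_of_pos (hα j) _) ⟨i, Finset.mem_univ i⟩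
  have hconst : ∀ j, α j ^ (1 / q - 1) = ∑ k, α k ^ (1 / q) := fun j => by
    have hj := congrFun h j
    rw [div_eq_iff hC.ne'] at hj
    rw [Real.rpow_sub_one (hα j).ne', hj, mul_div_cancel_left₀ _ (hα j).ne']
  have hexp : 1 / q - 1 ≠ 0 := (sub_pos.mpr ((one_lt_div hq0).mpr hq1)).ne'
  exact hik ((Real.rpow_left_inj (hα i).le (hα k).le hexp).mp ((hconst i).trans (hconst k).symm))

theorem sum_mul_logqE_lt_escort {ι : Type*} [Fintype ι] [Nonempty ι] {q : ℝ} (hq0 : 0 < q)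
    (hq1 : q < 1) {α : ι → ℝ} (hα : ∀ j, 0 < α j) {θ : ι → ℝ} (hθ : ∀ j, 0 ≤ θ j)
    (hsum : ∑ j, θ j = 1) (hne : θ ≠ fun j => α j ^ (1 / q) / ∑ k, α k ^ (1 / q)) :
    ∑ j, (α j : EReal) * logqE q (θ j) <
      ∑ j, (α j : EReal) * logqE q (α j ^ (1 / q) / ∑ k, α k ^ (1 / q)) := by
  rw [sum_mul_logqE_of_ne_one hq1.ne, sum_mul_logqE_of_ne_one hq1.ne, EReal.coe_lt_coe_iff]
  set C := ∑ k, α k ^ (1 / q) with hCdef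
  have hC : 0 < C := Finset.sum_pos (fun j _ => Real.rpow_pos_of_pos (hα j) _) Finset.univ_nonempty
  have hφ : ∀ j, 0 < α j ^ (1 / q) / C := fun j => div_pos (Real.rpow_pos_of_pos (hα j) _) hC
  have hαφ : ∀ j, α j = C ^ q * (α j ^ (1 / q) / C) ^ q := fun j => by
    rw [← Real.mul_rpow hC.le (hφ j).le, mul_div_cancel₀ _ hC.ne', ← Real.rpow_mul (hα j).le,
      one_div_mul_cancel hq0.ne', Real.rpow_one]
  have hφsum : ∑ j, θ j = ∑ j, α j ^ (1 / q) / C := by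
    rw [← Finset.sum_div, hsum, ← hCdef, div_self hC.ne']
  have hlt := mul_lt_mul_of_pos_left (sum_rpow_mul_rpow_lt_of_ne hq0 hq1 hθ hφ hφsum hne)
    (Real.rpow_pos_of_pos hC q)
  simp only [Finset.mul_sum, ← mul_assoc, ← hαφ] at hlt
  simp only [mul_div_assoc', ← Finset.sum_div, mul_sub, Finset.sum_sub_distrib]
  exact div_lt_div_of_pos_right (sub_lt_sub_right hlt _) (sub_pos.mpr hq1)

/-- **propriety.** For `q ∈ (0,1]` consider the scoring rule
`S_q(θ, α) = ∑ j, α j * log_q (θ j)` on the probability simplex `Δ_K`, `K ≥ 2`, with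
`α` a positive probability vector.  (1) If `q = 1`, then `α` is the unique maximizer
of `θ ↦ S_1(θ, α)`: the rule is strictly proper.  (2) If `q ∈ (0,1)` and `α` is
non-uniform, then the unique maximizer is the escort `θ*_j = α_j^{1/q}/∑_k α_k^{1/q}`,
which differs from `α`; in particular `α` is not a maximizer. -/
theorem tsallis_scoring_rule_propriety
    {K : ℕ} (hK : 2 ≤ K) {q : ℝ} (hq0 : 0 < q) (hq1 : q ≤ 1)
    (α : Fin K → ℝ) (hα : ∀ j, 0 < α j) (hαsum : ∑ j, α j = 1) :
    let S : (Fin K → ℝ) → EReal := fun θ => ∑ j, (α j : EReal) * logqE q (θ j)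
    (q = 1 →
      ∀ θ : Fin K → ℝ, (∀ j, 0 ≤ θ j) → (∑ j, θ j = 1) → θ ≠ α → S θ < S α) ∧
    (q < 1 → (∃ j k, α j ≠ α k) →
      let θstar : Fin K → ℝ := fun j => α j ^ (1 / q) / ∑ k, α k ^ (1 / q)
      θstar ≠ α ∧
      (∀ θ : Fin K → ℝ, (∀ j, 0 ≤ θ j) → (∑ j, θ j = 1) → θ ≠ θstar →
        S θ < S θstar) ∧
      -- hence α is not a maximizer of S over the simplex
      (∃ θ : Fin K → ℝ, (∀ j, 0 ≤ θ j) ∧ (∑ j, θ j = 1) ∧ S α < S θ)) := by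
  intro S
  have : Nonempty (Fin K) := ⟨⟨0, by lia⟩⟩
  refine ⟨?_, fun hq hne => ?_⟩
  · rintro rfl θ hθ hsum hne
    have hSα : S α = ((∑ j, α j * Real.log (α j) : ℝ) : EReal) :=
      sum_mul_logqE_one α fun j => (hα j).ne'
    by_cases h0 : ∃ i, θ i = 0
    · obtain ⟨i, hi⟩ := h0
      have hbot : S θ = ⊥ := by
        refine EReal.finset_sum_eq_bot (Finset.mem_univ i) ?_
        simp [logqE, hi, EReal.coe_mul_bot_of_pos (hα i)]
      rw [hbot, hSα]
      exact EReal.bot_lt_coe _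
    · push Not at h0
      have hSθ : S θ = ((∑ j, α j * Real.log (θ j) : ℝ) : EReal) := sum_mul_logqE_one α h0
      rw [hSθ, hSα, EReal.coe_lt_coe_iff]
      exact sum_mul_log_lt_of_ne hα (fun j => (hθ j).lt_of_ne' (h0 j)) (hsum.trans hαsum.symm) hne
  · intro θstar
    have hstar : θstar ≠ α := escort_ne_self hq0 hq hα hne
    have hC : 0 < ∑ k, α k ^ (1 / q) :=
      Finset.sum_pos (fun j _ => Real.rpow_pos_of_pos (hα j) _) Finset.univ_nonempty
    refine ⟨hstar, fun θ hθ hsum h => sum_mul_logqE_lt_escort hq0 hq hα hθ hsum h, θstar,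
      fun j => div_nonneg (Real.rpow_nonneg (hα j).le _) hC.le, ?_,
      sum_mul_logqE_lt_escort hq0 hq hα (fun j => (hα j).le) hαsum hstar.symm⟩
    rw [← Finset.sum_div, div_self hC.ne']
end

section
/- Fix q ∈ [0,1), c > 0, and 0 < p₀ < δ ≤ 1/2. Let T > 0 and let p : [0,T] → (0,1) be differentiable with p(0) = p₀ and suppose p'(t) ≥ c² · p(t)^{2−q} for all t ∈ [0,T]. If p(t) < δ for all t ∈ [0,T], then T < (p₀^{−(1−q)} − δ^{−(1−q)}) / ((1−q) c²). Likewise, for q = 1: if p'(t) ≥ c² · p(t) on [0,T] and p(t) < δ on [0,T], then T < log(δ/p₀) / c². -/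
/-- Mean value inequality on `[0, T]`, stated for `HasDerivAt`. -/
theorem mul_le_sub_of_le_hasDerivAt {f f' : ℝ → ℝ} {k T : ℝ} (hT : 0 ≤ T)
    (hf : ∀ t ∈ Set.Icc (0 : ℝ) T, HasDerivAt f (f' t) t)
    (hk : ∀ t ∈ Set.Icc (0 : ℝ) T, k ≤ f' t) : k * T ≤ f T - f 0 := by
  have h := (convex_Icc (0 : ℝ) T).mul_sub_le_image_sub_of_le_deriv (f := f) (C := k)
    (fun t ht => (hf t ht).continuousAt.continuousWithinAt)
    (fun t ht => (hf t (interior_subset ht)).differentiableAt.differentiableWithinAt)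
    (fun t ht => by
      rw [(hf t (interior_subset ht)).deriv]
      exact hk t (interior_subset ht))
    0 (Set.left_mem_Icc.2 hT) T (Set.right_mem_Icc.2 hT) hT
  simpa using h

/-- **matching upper bound for cold-start escape.** Let `q ∈ [0,1]`,
`c > 0`, `0 < p₀ < δ ≤ 1/2`, and let a differentiable `p : [0,T] → (0,1)` start at
`p₀` with `p' ≥ c² p^{2−q}`.  If `p(t) < δ` throughout `[0,T]`, then for `q < 1`,
`T < (p₀^{−(1−q)} − δ^{−(1−q)}) / ((1−q) c²)`, and for `q = 1`,
`T < log(δ/p₀) / c²`. -/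
theorem cold_start_escape_upper_bound
    {q c p₀ δ T : ℝ} (hq0 : 0 ≤ q) (hq1 : q ≤ 1) (hc : 0 < c)
    (hp₀ : 0 < p₀) (hp₀δ : p₀ < δ) (hδ : δ ≤ 1 / 2) (hT : 0 < T)
    (p p' : ℝ → ℝ)
    (hmem : ∀ t ∈ Set.Icc (0 : ℝ) T, p t ∈ Set.Ioo (0 : ℝ) 1)
    (hderiv : ∀ t ∈ Set.Icc (0 : ℝ) T, HasDerivAt p (p' t) t)
    (hbound : ∀ t ∈ Set.Icc (0 : ℝ) T, c ^ 2 * (p t) ^ (2 - q) ≤ p' t)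
    (h0 : p 0 = p₀) (hstay : ∀ t ∈ Set.Icc (0 : ℝ) T, p t < δ) :
    (q < 1 → T < (p₀ ^ (-(1 - q)) - δ ^ (-(1 - q))) / ((1 - q) * c ^ 2)) ∧
    (q = 1 → T < Real.log (δ / p₀) / c ^ 2) := by
  have hTmem : T ∈ Set.Icc (0 : ℝ) T := Set.right_mem_Icc.2 hT.le
  have hpos : ∀ t ∈ Set.Icc (0 : ℝ) T, 0 < p t := fun t ht => (hmem t ht).1
  constructor
  · intro hq
    have hr : 0 < 1 - q := sub_pos.2 hq
    have h := mul_le_sub_of_le_hasDerivAt (k := (1 - q) * c ^ 2) hT.le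
      (fun t ht => ((hderiv t ht).rpow_const (p := -(1 - q)) (Or.inl (hpos t ht).ne')).neg)
      (fun t ht => by
        have hone : p t ^ (2 - q) * p t ^ (-(1 - q) - 1) = 1 := by
          rw [← Real.rpow_add (hpos t ht)]
          ring_nf
          exact Real.rpow_zero _
        calc (1 - q) * c ^ 2
            = (1 - q) * (c ^ 2 * p t ^ (2 - q) * p t ^ (-(1 - q) - 1)) := by
              rw [mul_assoc (c ^ 2), hone, mul_one]
          _ ≤ (1 - q) * (p' t * p t ^ (-(1 - q) - 1)) := by
              have := Real.rpow_nonneg (hpos t ht).le (-(1 - q) - 1)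
              have := hbound t ht
              gcongr
          _ = -(p' t * -(1 - q) * p t ^ (-(1 - q) - 1)) := by ring)
    have hlt : δ ^ (-(1 - q)) < p T ^ (-(1 - q)) :=
      Real.rpow_lt_rpow_of_neg (hpos T hTmem) (hstay T hTmem) (neg_lt_zero.2 hr)
    simp only [Pi.neg_apply, h0] at h
    rw [lt_div_iff₀ (by positivity)]
    linarith
  · rintro rfl
    have h := mul_le_sub_of_le_hasDerivAt (k := c ^ 2) hT.le
      (fun t ht => (hderiv t ht).log (hpos t ht).ne')
      (fun t ht => by
        rw [le_div_iff₀ (hpos t ht)]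
        have hb := hbound t ht
        norm_num at hb
        exact hb)
    have hlt : Real.log (p T) < Real.log δ :=
      Real.log_lt_log (hpos T hTmem) (hstay T hTmem)
    rw [h0] at h
    rw [lt_div_iff₀ (by positivity), Real.log_div (hp₀.trans hp₀δ).ne' hp₀.ne']
    linarith
end

section
/- Let σ(θ) = 1/(1 + e^{−θ}) be the logistic sigmoid, fix q ∈ [0,1], and let θ : I → ℝ be a differentiable solution of the gradient flow θ'(t) = −(d/dθ)[−log_q(σ(θ))] evaluated at θ(t), i.e. θ'(t) = σ(θ(t))^{−q} σ'(θ(t)). Then p(t) = σ(θ(t)) satisfies the exact ODE p'(t) = p(t)^{2−q} (1 − p(t))². -/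
/-- The logistic sigmoid `σ(θ) = 1/(1 + e^{−θ})`. -/
noncomputable def logistic (x : ℝ) : ℝ := 1 / (1 + Real.exp (-x))

theorem logistic_eq_sigmoid : logistic = Real.sigmoid := by
  funext x
  rw [logistic, Real.sigmoid_def, one_div]

/-- **exact sigmoid dynamics.** Fix `q ∈ [0,1]` and let `θ` solve the
gradient flow of `ℓ_q(θ) = −log_q(σ(θ))` on an open interval, i.e.
`θ'(t) = σ(θ(t))^{−q} σ'(θ(t))`.  Then `p(t) = σ(θ(t))` satisfies the exact ODE
`p'(t) = p(t)^{2−q} (1 − p(t))²`. -/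
theorem sigmoid_gradient_flow_dynamics
    {q : ℝ} (hq0 : 0 ≤ q) (hq1 : q ≤ 1)
    {a b : ℝ} (θ : ℝ → ℝ)
    (hflow : ∀ t ∈ Set.Ioo a b,
      HasDerivAt θ ((logistic (θ t)) ^ (-q) * deriv logistic (θ t)) t) :
    ∀ t ∈ Set.Ioo a b,
      HasDerivAt (fun s => logistic (θ s))
        ((logistic (θ t)) ^ (2 - q) * (1 - logistic (θ t)) ^ 2) t := by
  intro t ht
  have hθ := hflow t ht
  simp only [logistic_eq_sigmoid, Real.deriv_sigmoid] at hθ ⊢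
  refine ((Real.hasDerivAt_sigmoid (θ t)).comp t hθ).congr_deriv ?_
  have hpow : Real.sigmoid (θ t) ^ (2 - q) =
      Real.sigmoid (θ t) ^ 2 * Real.sigmoid (θ t) ^ (-q) := by
    rw [sub_eq_add_neg, Real.rpow_add (Real.sigmoid_pos _), Real.rpow_two]
  rw [hpow]
  ring
end
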